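/- arXiv:1410.7005 — 2 statements merged into one kernel-verified Lean document; each statement's English description precedes it below -/
import Mathlib

section
/- Among all joint pmfs Q̃ on {0,1}×{0,1} with uniform X-marginal (Q̃_X(0) = Q̃_X(1) = 1/2) and with crossover mass Q̃(0,1) + Q̃(1,0) = q̃, the divergence D(Q̃ ‖ P_X × W_θ) is minimized by the symmetric distribution Q̃*(x,y) = (1/2)(1−q̃)^{1{x=y}} q̃^{1{x≠y}}, and the minimum value equals the binary divergence D(q̃‖θ). -/
/-- The binary Kullback–Leibler divergence `D(q‖θ)` (natural log; `Real.log 0 = 0`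
realizes the convention `0 log 0 = 0`). -/
noncomputable def binDiv (q θ : ℝ) : ℝ :=
  q * Real.log (q / θ) + (1 - q) * Real.log ((1 - q) / (1 - θ))

/-- Midpoint convexity of the perspective `x ↦ x log (x / c)`. -/
theorem mul_log_div_midpoint_le {a b c : ℝ} (ha : 0 ≤ a) (hb : 0 ≤ b) (hc : 0 < c) :
    2 * ((a + b) / 2 * Real.log ((a + b) / 2 / c)) ≤
      a * Real.log (a / c) + b * Real.log (b / c) := by
  have h := Real.convexOn_mul_log.2 (Set.mem_Ici.2 (div_nonneg ha hc.le))
    (Set.mem_Ici.2 (div_nonneg hb hc.le))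
    (by norm_num : (0 : ℝ) ≤ 1 / 2) (by norm_num : (0 : ℝ) ≤ 1 / 2) (by norm_num)
  simp only [smul_eq_mul] at h
  have hmid : 1 / 2 * (a / c) + 1 / 2 * (b / c) = (a + b) / 2 / c := by ring
  rw [hmid] at h
  have key := mul_le_mul_of_nonneg_left h (by positivity : 0 ≤ 2 * c)
  calc 2 * ((a + b) / 2 * Real.log ((a + b) / 2 / c))
      = 2 * c * ((a + b) / 2 / c * Real.log ((a + b) / 2 / c)) := by field_simp
    _ ≤ _ := key
    _ = a * Real.log (a / c) + b * Real.log (b / c) := by field_simp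

/-- **Symmetric minimizer of the divergence to a BSC for fixed crossover mass.**
Let `θ ∈ (0,1)`, `q̃ ∈ [0,1]`. Among all joint pmfs `Q̃` on `{0,1}×{0,1}` (modeled
on `Bool × Bool`) with uniform `X`-marginal and crossover mass
`Q̃(0,1) + Q̃(1,0) = q̃`, the divergence
`D(Q̃‖P_X×W_θ) = Σ_{x,y} Q̃(x,y) log(Q̃(x,y)/((1/2)(1−θ)^{1{x=y}} θ^{1{x≠y}}))`
is minimized by `Q̃*(x,y) = (1/2)(1−q̃)^{1{x=y}} q̃^{1{x≠y}}`, and the minimum value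
equals the binary divergence `D(q̃‖θ)`. -/
theorem divergence_minimized_by_symmetric_bsc
    (θ qt : ℝ) (hθ : θ ∈ Set.Ioo (0 : ℝ) 1) (hqt : qt ∈ Set.Icc (0 : ℝ) 1)
    (Qstar : Bool → Bool → ℝ)
    (hQstar : ∀ x y, Qstar x y = (1 / 2) * (if x = y then 1 - qt else qt)) :
    (∀ Q : Bool → Bool → ℝ, (∀ x y, 0 ≤ Q x y) → (∑ x, ∑ y, Q x y = 1) →
        (∀ x, ∑ y, Q x y = 1 / 2) → Q false true + Q true false = qt →
        (∑ x, ∑ y, Qstar x y *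
            Real.log (Qstar x y / ((1 / 2) * (if x = y then 1 - θ else θ))))
          ≤ ∑ x, ∑ y, Q x y *
              Real.log (Q x y / ((1 / 2) * (if x = y then 1 - θ else θ)))) ∧
      (∑ x, ∑ y, Qstar x y *
          Real.log (Qstar x y / ((1 / 2) * (if x = y then 1 - θ else θ))))
        = binDiv qt θ := by
  obtain ⟨hθ0, hθ1⟩ := hθ
  simp only [Fintype.sum_bool, hQstar, reduceCtorEq, if_true, if_false]
  refine ⟨fun Q hQ hsum _ hcross => ?_, ?_⟩
  · have hdiag : Q true true + Q false false = 1 - qt := by linarith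
    have h₁ := mul_log_div_midpoint_le (hQ true true) (hQ false false)
      (by linarith : 0 < 1 / 2 * (1 - θ))
    have h₂ := mul_log_div_midpoint_le (hQ false true) (hQ true false)
      (by linarith : 0 < 1 / 2 * θ)
    rw [hdiag, div_eq_inv_mul, ← one_div] at h₁
    rw [hcross, div_eq_inv_mul, ← one_div] at h₂
    linarith
  · have hhalf : (1 / 2 : ℝ) ≠ 0 := by norm_num
    rw [mul_div_mul_left _ _ hhalf, mul_div_mul_left _ _ hhalf, binDiv]
    ring
end

section
/- Reduction of the BSC exponent optimization to an interval: let θ ∈ (0,1/2), R ∈ (0, log 2), T ≥ 0, β = log((1−θ)/θ), and assume θ + T/β ≤ δ_GV(R). Then min_{q̃∈[0,1]} [ D(q̃‖θ) + max{0, log 2 − R − h(min{1/2, q̃ + T/β})} ] = min_{q̃∈[θ, δ_GV(R) − T/β]} [ D(q̃‖θ) − h(q̃ + T/β) ] + log 2 − R. -/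
/-- The binary entropy function `h(p) = −p log p − (1−p) log(1−p)` (natural log;
`Real.log 0 = 0` realizes the convention `0 log 0 = 0`). -/
noncomputable def binEnt (p : ℝ) : ℝ :=
  -p * Real.log p - (1 - p) * Real.log (1 - p)

open Set

theorem binEnt_eq_binEntropy : binEnt = Real.binEntropy := by
  funext p
  simp only [binEnt, Real.binEntropy, Real.log_inv]
  ring

theorem monotoneOn_binEnt : MonotoneOn binEnt (Icc 0 (1 / 2)) := by
  rw [binEnt_eq_binEntropy, one_div]
  exact Real.binEntropy_strictMonoOn.monotoneOn

theorem mul_log_div {q θ : ℝ} (hθ : θ ≠ 0) :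
    q * Real.log (q / θ) = q * Real.log q - q * Real.log θ := by
  rcases eq_or_ne q 0 with rfl | hq
  · simp
  · rw [Real.log_div hq hθ]
    ring

theorem binDiv_eq {θ : ℝ} (h0 : 0 < θ) (h1 : θ < 1) (q : ℝ) :
    binDiv q θ = -binEnt q + (q * (Real.log (1 - θ) - Real.log θ) - Real.log (1 - θ)) := by
  rw [binDiv, mul_log_div h0.ne', mul_log_div (sub_pos.2 h1).ne', binEnt]
  ring

theorem convexOn_binDiv {θ : ℝ} (h0 : 0 < θ) (h1 : θ < 1) :
    ConvexOn ℝ (Icc 0 1) (fun q => binDiv q θ) := by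
  have hent : ConvexOn ℝ (Icc 0 1) (-binEnt) := by
    rw [binEnt_eq_binEntropy]
    exact Real.strictConcave_binEntropy.concaveOn.neg
  have haff : ConvexOn ℝ (Icc (0 : ℝ) 1)
      (fun q => q * (Real.log (1 - θ) - Real.log θ) - Real.log (1 - θ)) := by
    refine ⟨convex_Icc 0 1, fun x _ y _ a b _ _ hab => le_of_eq ?_⟩
    simp only [smul_eq_mul]
    linear_combination Real.log (1 - θ) * hab
  exact (hent.add haff).congr fun q _ => (binDiv_eq h0 h1 q).symm

theorem binDiv_self {θ : ℝ} (h0 : 0 < θ) (h1 : θ < 1) : binDiv θ θ = 0 := by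
  simp [binDiv, div_self h0.ne', div_self (sub_pos.2 h1).ne']

theorem sub_le_mul_log_div {q θ : ℝ} (hq : 0 ≤ q) (hθ : 0 < θ) :
    q - θ ≤ q * Real.log (q / θ) := by
  rcases hq.eq_or_lt with rfl | hq
  · simpa using hθ.le
  · have h := mul_le_mul_of_nonneg_left (Real.one_sub_inv_le_log_of_pos (div_pos hq hθ)) hq.le
    have heq : q * (1 - (q / θ)⁻¹) = q - θ := by
      field_simp
    linarith

theorem binDiv_nonneg {q θ : ℝ} (hq : q ∈ Icc (0 : ℝ) 1) (h0 : 0 < θ) (h1 : θ < 1) :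
    0 ≤ binDiv q θ := by
  have hl := sub_le_mul_log_div hq.1 h0
  have hr := sub_le_mul_log_div (sub_nonneg.2 hq.2) (sub_pos.2 h1)
  rw [binDiv]
  linarith

theorem monotoneOn_binDiv {θ : ℝ} (h0 : 0 < θ) (h1 : θ < 1) :
    MonotoneOn (fun q => binDiv q θ) (Icc θ 1) := by
  intro a ha b hb hab
  have hθ : θ ∈ Icc (0 : ℝ) 1 := ⟨h0.le, h1.le⟩
  have ha' : a ∈ Icc (0 : ℝ) 1 := ⟨h0.le.trans ha.1, ha.2⟩
  have hb' : b ∈ Icc (0 : ℝ) 1 := ⟨h0.le.trans hb.1, hb.2⟩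
  have hmem : a ∈ segment ℝ θ b := by
    rw [segment_eq_Icc hb.1]
    exact ⟨ha.1, hab⟩
  have hmax := (convexOn_binDiv h0 h1).le_on_segment hθ hb' hmem
  simpa only [binDiv_self h0 h1, max_eq_right (binDiv_nonneg hb' h0 h1)] using hmax

/-- **Reduction of the BSC exponent optimization to an interval.** Let `θ ∈ (0,1/2)`,
`R ∈ (0, log 2)`, `T ≥ 0`, `β = log((1−θ)/θ)`, `δ_GV(R) ∈ [0,1/2]` with
`h(δ_GV(R)) = log 2 − R`, and assume `θ + T/β ≤ δ_GV(R)`. Then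
`min_{q̃∈[0,1]} [D(q̃‖θ) + max{0, log 2 − R − h(min{1/2, q̃ + T/β})}]
  = min_{q̃∈[θ, δ_GV(R) − T/β]} [D(q̃‖θ) − h(q̃ + T/β)] + log 2 − R`. -/
theorem bsc_exponent_interval_reduction
    (θ R T : ℝ) (hθ : θ ∈ Set.Ioo (0 : ℝ) (1 / 2))
    (hR : R ∈ Set.Ioo (0 : ℝ) (Real.log 2)) (hT : 0 ≤ T)
    (β : ℝ) (hβ : β = Real.log ((1 - θ) / θ))
    (δGV : ℝ) (hδ : δGV ∈ Set.Icc (0 : ℝ) (1 / 2))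
    (hGV : binEnt δGV = Real.log 2 - R)
    (hcon : θ + T / β ≤ δGV) :
    sInf ((fun q => binDiv q θ +
        max 0 (Real.log 2 - R - binEnt (min (1 / 2) (q + T / β)))) '' Set.Icc 0 1)
      = sInf ((fun q => binDiv q θ - binEnt (q + T / β)) '' Set.Icc θ (δGV - T / β))
        + (Real.log 2 - R) := by
  obtain ⟨hθ0, hθ2⟩ := hθ
  have hθ1 : θ < 1 := by linarith
  have ht : 0 ≤ T / β := by
    refine div_nonneg hT ?_
    rw [hβ]
    refine Real.log_nonneg ?_
    rw [le_div_iff₀ hθ0]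
    linarith
  generalize T / β = t at *
  obtain ⟨-, hδ2⟩ := hδ
  have hobj : ∀ q ∈ Icc θ (δGV - t),
      binDiv q θ + max 0 (Real.log 2 - R - binEnt (min (1 / 2) (q + t)))
        = binDiv q θ - binEnt (q + t) + (Real.log 2 - R) := by
    rintro q ⟨hq1, hq2⟩
    have hent : binEnt (q + t) ≤ binEnt δGV :=
      monotoneOn_binEnt ⟨by linarith, by linarith⟩ ⟨by linarith, hδ2⟩ (by linarith)
    rw [min_eq_right (by linarith), max_eq_right (by linarith)]
    ring
  have hbdd : BddBelow ((fun q => binDiv q θ +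
      max 0 (Real.log 2 - R - binEnt (min (1 / 2) (q + t)))) '' Icc 0 1) := by
    refine ⟨0, ?_⟩
    rintro _ ⟨q, hq, rfl⟩
    exact add_nonneg (binDiv_nonneg hq hθ0 hθ1) (le_max_left _ _)
  have hsub : Icc θ (δGV - t) ⊆ Icc 0 1 :=
    Icc_subset_Icc hθ0.le (by linarith)
  have hbdd' : BddBelow ((fun q => binDiv q θ - binEnt (q + t)) '' Icc θ (δGV - t)) := by
    refine ⟨-(Real.log 2 - R), ?_⟩
    rintro _ ⟨q, hq, rfl⟩
    have h0 := add_nonneg (binDiv_nonneg (hsub hq) hθ0 hθ1)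
      (le_max_left 0 (Real.log 2 - R - binEnt (min (1 / 2) (q + t))))
    have h := hobj q hq
    dsimp only
    linarith
  have hθmem : θ ∈ Icc θ (δGV - t) := ⟨le_rfl, by linarith⟩
  have hδmem : δGV - t ∈ Icc θ (δGV - t) := ⟨by linarith, le_rfl⟩
  apply le_antisymm
  · rw [← sub_le_iff_le_add]
    refine le_csInf (Set.Nonempty.image _ ⟨θ, hθmem⟩) ?_
    rintro _ ⟨q, hq, rfl⟩
    have hle := csInf_le hbdd (mem_image_of_mem _ (hsub hq))
    have h := hobj q hq
    dsimp only at hle ⊢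
    linarith
  · refine le_csInf (Set.Nonempty.image _ ⟨θ, hsub hθmem⟩) ?_
    rintro _ ⟨q, hq, rfl⟩
    rw [← le_sub_iff_add_le]
    rcases lt_or_ge q θ with hqθ | hqθ
    · refine (csInf_le hbdd' (mem_image_of_mem _ hθmem)).trans ?_
      have hdiv := binDiv_nonneg hq hθ0 hθ1
      have hself := binDiv_self hθ0 hθ1
      have hent : binEnt (q + t) ≤ binEnt (θ + t) :=
        monotoneOn_binEnt ⟨by linarith [hq.1], by linarith⟩ ⟨by linarith, by linarith⟩
          (by linarith)
      have hmax := le_max_right 0 (Real.log 2 - R - binEnt (min (1 / 2) (q + t)))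
      dsimp only
      rw [min_eq_right (by linarith : q + t ≤ 1 / 2)] at hmax ⊢
      linarith
    · rcases le_or_gt q (δGV - t) with hqδ | hqδ
      · refine (csInf_le hbdd' (mem_image_of_mem _ ⟨hqθ, hqδ⟩)).trans ?_
        have h := hobj q ⟨hqθ, hqδ⟩
        dsimp only
        linarith
      · refine (csInf_le hbdd' (mem_image_of_mem _ hδmem)).trans ?_
        have hdiv := monotoneOn_binDiv hθ0 hθ1 ⟨hδmem.1, (hsub hδmem).2⟩ ⟨hqθ, hq.2⟩ hqδ.le
        have hmax := le_max_left 0 (Real.log 2 - R - binEnt (min (1 / 2) (q + t)))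
        dsimp only at hdiv ⊢
        rw [sub_add_cancel, hGV]
        linarith
end
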